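/- Theorem 1.1(e). Fix an integer i ≥ 3 and a real number x with 1/i < x < 1/(i−1), and suppose k = k(n) = n^{1 + x + o(1)}, i.e. ln k(n) / ln n → 1 + x as n → ∞. Then asymptotically almost surely ξ(K_n, k) = i. -/

import Mathlib

open Finset Filter

/-- Positions: `p t a` is the vertex (an element of `Fin n`) occupied by agent `a` at the end of
round `t`. `greenSet n k p t` is the set of green agents at the end of round `t`; the initially
green agent is the agent with index `0`, and a white agent becomes green as soon as it occupies
the same vertex as a green agent. -/
def greenSet (n k : ℕ) (p : ℕ → Fin k → Fin n) : ℕ → Finset (Fin k)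
  | 0 => Finset.univ.filter fun a => ∃ b : Fin k, (b : ℕ) = 0 ∧ p 0 a = p 0 b
  | t + 1 =>
      greenSet n k p t ∪
        Finset.univ.filter fun a => ∃ b ∈ greenSet n k p t, p (t + 1) a = p (t + 1) b

/-- The probability that the `k` agents follow the trajectory prefix `p` during rounds
`0, 1, …, T`: each agent starts at a uniformly random vertex of `K_n` and then moves, each round
and independently of everything else, to a uniformly random vertex distinct from its current
one. -/
noncomputable def prefixProb (n k T : ℕ) (p : Fin (T + 1) → Fin k → Fin n) : ℝ :=
  ∏ a : Fin k, ((n : ℝ)⁻¹ *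
    ∏ t : Fin T, if p t.succ a = p t.castSucc a then 0 else ((n : ℝ) - 1)⁻¹)

/-- `probXiLe n k T` is `P(ξ(K_n, k) ≤ T)`: the probability that the broadcast is complete by
the end of round `T`. -/
noncomputable def probXiLe (n k T : ℕ) : ℝ :=
  ∑ p : Fin (T + 1) → Fin k → Fin n,
    if greenSet n k (fun t a => p ⟨min t T, Nat.lt_succ_of_le (min_le_right t T)⟩ a) T
        = Finset.univ
      then prefixProb n k T p else 0

/-- `probXiEq n k t` is `P(ξ(K_n, k) = t)`. -/
noncomputable def probXiEq (n k : ℕ) : ℕ → ℝ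
  | 0 => probXiLe n k 0
  | t + 1 => probXiLe n k (t + 1) - probXiLe n k t

/-- `probXiMem n k S` is `P(ξ(K_n, k) ∈ S)`: the probability that the broadcasting time of the
process with `k` agents on `K_n` belongs to the set `S ⊆ ℕ`. -/
noncomputable def probXiMem (n k : ℕ) (S : Set ℕ) : ℝ :=
  ∑' t, S.indicator (probXiEq n k) t

/-- `expXi n k = E[ξ(K_n, k)] = ∑_{t ≥ 0} P(ξ(K_n, k) > t)`. -/
noncomputable def expXi (n k : ℕ) : ℝ :=
  ∑' t, (1 - probXiLe n k t)

/-- The expectation of `f r` when the agents `a` choose independent positions `r a`, the law of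
`r a` having weights `μ a`. -/
noncomputable def indepExp {n k : ℕ} (μ : Fin k → Fin n → ℝ) (f : (Fin k → Fin n) → ℝ) : ℝ :=
  ∑ r, (∏ a, μ a (r a)) * f r

/-- The green agents once the agents in `S` have greened everybody sharing a vertex with them. -/
def spread {n k : ℕ} (r : Fin k → Fin n) (S : Finset (Fin k)) : Finset (Fin k) :=
  S ∪ Finset.univ.filter fun a => ∃ b ∈ S, r a = r b

/-- The probability of moving from `u` to `w` in one round. -/
noncomputable def moveProb {n : ℕ} (u w : Fin n) : ℝ := if w = u then 0 else ((n : ℝ) - 1)⁻¹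

/-- The expectation of a function of the positions and of the set of green agents at the end of
round `t`. -/
noncomputable def greenExp (n k : ℕ) :
    ℕ → ((Fin k → Fin n) → Finset (Fin k) → ℝ) → ℝ
  | 0, F => indepExp (fun _ _ => (n : ℝ)⁻¹)
      fun r => F r (spread r (Finset.univ.filter fun a => (a : ℕ) = 0))
  | t + 1, F => greenExp n k t fun q S =>
      indepExp (fun a => moveProb (q a)) fun r => F r (spread r S)

/-- The vertices all of whose occupants are in `S`. -/
def captured {n k : ℕ} (q : Fin k → Fin n) (S : Finset (Fin k)) : Finset (Fin n) :=
  Finset.univ.filter fun u => ∀ a, q a = u → a ∈ S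

section IndepExp

variable {n k : ℕ} {μ : Fin k → Fin n → ℝ} {f g : (Fin k → Fin n) → ℝ}

theorem indepExp_mono (hμ : ∀ a w, 0 ≤ μ a w) (h : ∀ r, f r ≤ g r) :
    indepExp μ f ≤ indepExp μ g :=
  Finset.sum_le_sum fun r _ =>
    mul_le_mul_of_nonneg_left (h r) (Finset.prod_nonneg fun a _ => hμ a _)

theorem indepExp_add : indepExp μ (fun r => f r + g r) = indepExp μ f + indepExp μ g := by
  simp only [indepExp, mul_add, Finset.sum_add_distrib]

theorem indepExp_const_mul (c : ℝ) : indepExp μ (fun r => c * f r) = c * indepExp μ f := by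
  simp only [indepExp, Finset.mul_sum]
  exact Finset.sum_congr rfl fun r _ => by ring

theorem indepExp_sum {ι : Type*} (s : Finset ι) (F : ι → (Fin k → Fin n) → ℝ) :
    indepExp μ (fun r => ∑ j ∈ s, F j r) = ∑ j ∈ s, indepExp μ (F j) := by
  simp only [indepExp, Finset.mul_sum]
  exact Finset.sum_comm

theorem indepExp_prod (g : Fin k → Fin n → ℝ) :
    indepExp μ (fun r => ∏ a, g a (r a)) = ∏ a, ∑ w, μ a w * g a w := by
  rw [Finset.prod_univ_sum, Fintype.piFinset_univ, indepExp]
  exact Finset.sum_congr rfl fun r _ => Finset.prod_mul_distrib.symm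

theorem indepExp_const (h1 : ∀ a, ∑ w, μ a w = 1) (c : ℝ) : indepExp μ (fun _ => c) = c := by
  have h := indepExp_prod (μ := μ) fun _ _ => 1
  simp only [Finset.prod_const_one, mul_one, h1] at h
  have h2 := indepExp_const_mul (μ := μ) (f := fun _ => 1) c
  rw [h] at h2
  simpa using h2

theorem indepExp_forall_mem (h1 : ∀ a, ∑ w, μ a w = 1) (S : Finset (Fin k))
    (U : Finset (Fin n)) :
    indepExp μ (fun r => if ∀ a ∈ S, r a ∈ U then 1 else 0) = ∏ a ∈ S, ∑ w ∈ U, μ a w := by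
  have h := indepExp_prod (μ := μ) fun a w => if a ∈ S → w ∈ U then 1 else 0
  have h2 : ∀ r : Fin k → Fin n, (∏ a, if a ∈ S → r a ∈ U then (1 : ℝ) else 0)
      = if ∀ a ∈ S, r a ∈ U then 1 else 0 := by
    intro r
    rw [Finset.prod_ite_zero]
    simp
  simp only [h2] at h
  rw [h, ← Finset.prod_subset (Finset.subset_univ S)]
  · refine Finset.prod_congr rfl fun a ha => ?_
    simp [ha, Finset.sum_ite_mem]
  · intro a _ ha
    simp [ha, h1]

theorem indepExp_forall_mem_le (hμ : ∀ a w, 0 ≤ μ a w) (h1 : ∀ a, ∑ w, μ a w = 1)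
    {S R : Finset (Fin k)} (hRS : R ⊆ S) (U : Finset (Fin n)) {c : ℝ}
    (hc : ∀ a ∈ R, ∑ w ∈ U, μ a w ≤ c) :
    indepExp μ (fun r => if ∀ a ∈ S, r a ∈ U then 1 else 0) ≤ c ^ R.card := by
  refine (indepExp_mono (g := fun r => if ∀ a ∈ R, r a ∈ U then 1 else 0) hμ fun r => ?_).trans ?_
  · split_ifs with h h'
    · exact le_rfl
    · exact absurd (fun a ha => h a (hRS ha)) h'
    · exact zero_le_one
    · exact le_rfl
  · rw [indepExp_forall_mem h1]
    refine (Finset.prod_le_prod (fun a _ => Finset.sum_nonneg fun w _ => hμ a w) hc).trans ?_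
    rw [Finset.prod_const]

theorem indepExp_meet_le (hμ : ∀ a w, 0 ≤ μ a w) (h1 : ∀ a, ∑ w, μ a w = 1) {c : ℝ}
    (hc : ∀ a w, μ a w ≤ c) {a b : Fin k} (hab : a ≠ b) :
    indepExp μ (fun r => if r a = r b then 1 else 0) ≤ c := by
  have h : (fun r : Fin k → Fin n => if r a = r b then (1 : ℝ) else 0) =
      fun r => ∑ u, if ∀ d ∈ ({a, b} : Finset (Fin k)), r d ∈ ({u} : Finset (Fin n))
        then 1 else 0 := by
    funext r
    simp only [Finset.mem_insert, Finset.mem_singleton, forall_eq_or_imp, forall_eq]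
    split_ifs with h
    · rw [h]; simp
    · symm
      refine Finset.sum_eq_zero fun u _ => if_neg ?_
      rintro ⟨h1, h2⟩
      exact h (h1.trans h2.symm)
  rw [h, indepExp_sum]
  simp only [indepExp_forall_mem h1, Finset.prod_pair hab, Finset.sum_singleton]
  calc ∑ u, μ a u * μ b u ≤ ∑ u, c * μ b u :=
        Finset.sum_le_sum fun u _ => mul_le_mul_of_nonneg_right (hc a u) (hμ b u)
    _ = c := by rw [← Finset.mul_sum, h1, mul_one]

theorem indepExp_card_spread_le (hμ : ∀ a w, 0 ≤ μ a w) (h1 : ∀ a, ∑ w, μ a w = 1) {c : ℝ}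
    (hc0 : 0 ≤ c) (hc : ∀ a w, μ a w ≤ c) (S : Finset (Fin k)) :
    indepExp μ (fun r => ((spread r S).card : ℝ)) ≤ (1 + k * c) * S.card := by
  have h : ∀ r : Fin k → Fin n, ((spread r S).card : ℝ) ≤
      S.card + ∑ b ∈ S, ∑ a ∈ Finset.univ.erase b, if r a = r b then 1 else 0 := by
    intro r
    have hsub : spread r S ⊆
        S ∪ S.biUnion fun b => (Finset.univ.erase b).filter fun a => r a = r b := by
      intro a ha
      simp only [spread, Finset.mem_union, Finset.mem_filter, Finset.mem_univ, true_and,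
        Finset.mem_biUnion, Finset.mem_erase, and_true] at ha ⊢
      by_cases haS : a ∈ S
      · exact Or.inl haS
      · obtain ⟨b, hb, hr⟩ := ha.resolve_left haS
        exact Or.inr ⟨b, hb, fun hab => haS (hab ▸ hb), hr⟩
    have h2 := (Finset.card_le_card hsub).trans ((Finset.card_union_le _ _).trans
      (Nat.add_le_add_left Finset.card_biUnion_le _))
    simp only [Finset.sum_boole]
    exact_mod_cast h2
  refine (indepExp_mono hμ h).trans ?_
  rw [indepExp_add, indepExp_const h1, indepExp_sum]
  have h2 : ∀ b ∈ S, indepExp μ (fun r => ∑ a ∈ Finset.univ.erase b,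
      if r a = r b then (1 : ℝ) else 0) ≤ k * c := by
    intro b _
    rw [indepExp_sum]
    refine (Finset.sum_le_card_nsmul _ _ c fun a ha =>
      indepExp_meet_le hμ h1 hc (Finset.ne_of_mem_erase ha)).trans ?_
    rw [nsmul_eq_mul]
    refine mul_le_mul_of_nonneg_right ?_ hc0
    exact_mod_cast (Finset.card_erase_le).trans (by simp)
  have h3 := Finset.sum_le_card_nsmul _ _ _ h2
  rw [nsmul_eq_mul] at h3
  linarith

end IndepExp

section MoveProb

variable {n : ℕ}

theorem moveProb_nonneg (hn : 1 ≤ n) (u w : Fin n) : 0 ≤ moveProb u w := by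
  have : (1 : ℝ) ≤ n := by exact_mod_cast hn
  unfold moveProb
  split_ifs
  · exact le_rfl
  · exact inv_nonneg.2 (by linarith)

theorem moveProb_le (hn : 1 ≤ n) (u w : Fin n) : moveProb u w ≤ ((n : ℝ) - 1)⁻¹ := by
  have : (1 : ℝ) ≤ n := by exact_mod_cast hn
  unfold moveProb
  split_ifs
  · exact inv_nonneg.2 (by linarith)
  · exact le_rfl

theorem moveProb_comm (u w : Fin n) : moveProb u w = moveProb w u := by
  simp only [moveProb, eq_comm]

theorem sum_moveProb (hn : 2 ≤ n) (u : Fin n) : ∑ w, moveProb u w = 1 := by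
  have : (2 : ℝ) ≤ n := by exact_mod_cast hn
  have h : ((n - 1 : ℕ) : ℝ) = (n : ℝ) - 1 := by
    rw [Nat.cast_sub (by omega), Nat.cast_one]
  rw [← Finset.add_sum_erase _ _ (Finset.mem_univ u), Finset.sum_congr rfl
    (f := moveProb u) (g := fun _ => ((n : ℝ) - 1)⁻¹)
    fun w hw => if_neg (Finset.ne_of_mem_erase hw)]
  rw [Finset.sum_const, Finset.card_erase_of_mem (Finset.mem_univ u), Finset.card_univ,
    Fintype.card_fin, nsmul_eq_mul, h, moveProb, if_pos rfl, zero_add,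
    mul_inv_cancel₀ (by linarith)]

theorem sum_moveProb_le (hn : 1 ≤ n) (u : Fin n) (U : Finset (Fin n)) :
    ∑ w ∈ U, moveProb u w ≤ U.card / ((n : ℝ) - 1) := by
  have h := Finset.sum_le_card_nsmul U _ _ fun w _ => moveProb_le hn u w
  rwa [nsmul_eq_mul, ← div_eq_mul_inv] at h

theorem sum_erase_moveProb (hn : 2 ≤ n) {u w : Fin n} (h : w ≠ u) :
    ∑ z ∈ Finset.univ.erase w, moveProb u z = 1 - ((n : ℝ) - 1)⁻¹ := by
  have h2 := Finset.add_sum_erase _ (moveProb u) (Finset.mem_univ w)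
  rw [sum_moveProb hn, moveProb, if_neg h] at h2
  linarith

theorem sum_uniform (hn : 1 ≤ n) : ∑ _w : Fin n, (n : ℝ)⁻¹ = 1 := by
  have : (1 : ℝ) ≤ n := by exact_mod_cast hn
  rw [Finset.sum_const, Finset.card_univ, Fintype.card_fin, nsmul_eq_mul,
    mul_inv_cancel₀ (by linarith)]

end MoveProb

section GreenExp

variable {n k : ℕ} {F G : (Fin k → Fin n) → Finset (Fin k) → ℝ}

theorem greenExp_mono (hn : 1 ≤ n) (t : ℕ) (h : ∀ q S, F q S ≤ G q S) :
    greenExp n k t F ≤ greenExp n k t G := by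
  induction t generalizing F G with
  | zero => exact indepExp_mono (fun _ _ => by positivity) fun r => h _ _
  | succ t ih =>
    exact ih fun q S => indepExp_mono (fun _ _ => moveProb_nonneg hn _ _) fun r => h _ _

theorem greenExp_add (t : ℕ) :
    greenExp n k t (fun q S => F q S + G q S) = greenExp n k t F + greenExp n k t G := by
  induction t generalizing F G with
  | zero => exact indepExp_add
  | succ t ih => simp only [greenExp, indepExp_add, ih]

theorem greenExp_const_mul (t : ℕ) (c : ℝ) :
    greenExp n k t (fun q S => c * F q S) = c * greenExp n k t F := by
  induction t generalizing F with
  | zero => exact indepExp_const_mul c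
  | succ t ih => simp only [greenExp, indepExp_const_mul, ih]

theorem greenExp_const (hn : 2 ≤ n) (t : ℕ) (c : ℝ) : greenExp n k t (fun _ _ => c) = c := by
  induction t with
  | zero => exact indepExp_const (fun _ => sum_uniform (by omega)) c
  | succ t ih => simp only [greenExp, indepExp_const fun _ => sum_moveProb hn _, ih]

theorem greenExp_sum {ι : Type*} (t : ℕ) (s : Finset ι)
    (F : ι → (Fin k → Fin n) → Finset (Fin k) → ℝ) :
    greenExp n k t (fun q S => ∑ j ∈ s, F j q S) = ∑ j ∈ s, greenExp n k t (F j) := by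
  induction t generalizing F with
  | zero => exact indepExp_sum _ _
  | succ t ih => simp only [greenExp, indepExp_sum, ih]

theorem greenExp_prod (hn : 2 ≤ n) (t : ℕ) (f : Fin n → ℝ) :
    greenExp n k t (fun q _ => ∏ a, f (q a)) = ((n : ℝ)⁻¹ * ∑ w, f w) ^ k := by
  induction t generalizing f with
  | zero =>
    have h := indepExp_prod (n := n) (k := k) (μ := fun _ _ => (n : ℝ)⁻¹) fun _ => f
    simpa [greenExp, ← Finset.mul_sum] using h
  | succ t ih =>
    have h : ∀ q : Fin k → Fin n, indepExp (fun a => moveProb (q a)) (fun r => ∏ a, f (r a)) =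
        ∏ a, ∑ w, moveProb (q a) w * f w := fun q => indepExp_prod fun _ => f
    simp only [greenExp, h]
    rw [ih fun u => ∑ w, moveProb u w * f w, Finset.sum_comm]
    simp only [← Finset.sum_mul, fun u w : Fin n => moveProb_comm u w, sum_moveProb hn, one_mul]

theorem greenExp_card_le (hn : 2 ≤ n) (t : ℕ) :
    greenExp n k t (fun _ S => (S.card : ℝ)) ≤ (1 + k * ((n : ℝ) - 1)⁻¹) ^ (t + 1) := by
  have hn' : (2 : ℝ) ≤ n := by exact_mod_cast hn
  have hinv : (0 : ℝ) ≤ ((n : ℝ) - 1)⁻¹ := inv_nonneg.2 (by linarith)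
  induction t with
  | zero =>
    rw [greenExp]
    have hle : ((n : ℝ))⁻¹ ≤ ((n : ℝ) - 1)⁻¹ := inv_anti₀ (by linarith) (by linarith)
    refine (indepExp_card_spread_le (fun _ _ => by positivity)
      (fun _ => sum_uniform (by omega)) hinv (fun _ _ => hle) _).trans ?_
    rw [zero_add, pow_one]
    refine mul_le_of_le_one_right (by positivity) ?_
    have : (Finset.univ.filter fun a : Fin k => (a : ℕ) = 0).card ≤ 1 := by
      rw [Finset.card_le_one]
      simp only [Finset.mem_filter, Finset.mem_univ, true_and]
      intro a ha b hb
      exact Fin.ext (ha.trans hb.symm)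
    exact_mod_cast this
  | succ t ih =>
    rw [greenExp]
    have h : ∀ (q : Fin k → Fin n) (S : Finset (Fin k)),
        indepExp (fun a => moveProb (q a)) (fun r => ((spread r S).card : ℝ)) ≤
          (1 + k * ((n : ℝ) - 1)⁻¹) * S.card := fun q S =>
      indepExp_card_spread_le (μ := fun a => moveProb (q a))
        (fun a w => moveProb_nonneg (by omega) (q a) w) (fun a => sum_moveProb hn (q a)) hinv
        (fun a w => moveProb_le (by omega) (q a) w) S
    refine (greenExp_mono (by omega) t h).trans ?_
    rw [greenExp_const_mul, pow_succ' _ (t + 1)]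
    exact mul_le_mul_of_nonneg_left ih (by positivity)

/-- A vertex is unlikely to hold much fewer than `k / n` agents. -/
theorem greenExp_exists_card_lt_le (hn : 2 ≤ n) (t s : ℕ) :
    greenExp n k t (fun q _ => if ∃ u, (Finset.univ.filter fun a => q a = u).card < s
      then 1 else 0) ≤ n * 2 ^ s * Real.exp (-(k / (2 * n))) := by
  have hn' : (2 : ℝ) ≤ n := by exact_mod_cast hn
  have hprod : ∀ (q : Fin k → Fin n) (u : Fin n), (∏ a, if q a = u then (1 / 2 : ℝ) else 1) =
      (1 / 2) ^ (Finset.univ.filter fun a => q a = u).card := by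
    intro q u
    rw [Finset.prod_ite, Finset.prod_const, Finset.prod_const_one, mul_one]
  have hpt : ∀ (q : Fin k → Fin n) (S : Finset (Fin k)),
      (if ∃ u, (Finset.univ.filter fun a => q a = u).card < s then (1 : ℝ) else 0) ≤
        ∑ u, 2 ^ s * ∏ a, if q a = u then (1 / 2 : ℝ) else 1 := by
    intro q S
    simp only [hprod]
    split_ifs with h
    · obtain ⟨u, hu⟩ := h
      refine le_trans ?_ (Finset.single_le_sum (fun _ _ => by positivity) (Finset.mem_univ u))
      rw [one_div, inv_pow, ← div_eq_mul_inv, one_le_div (by positivity)]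
      exact pow_le_pow_right₀ one_le_two hu.le
    · positivity
  refine (greenExp_mono (by omega) t hpt).trans ?_
  rw [greenExp_sum]
  have hsum : ∀ u : Fin n, (n : ℝ)⁻¹ * ∑ w, (if w = u then (1 / 2 : ℝ) else 1) =
      1 - 1 / (2 * n) := by
    intro u
    have h : ∀ w, (if w = u then (1 / 2 : ℝ) else 1) = 1 - if w = u then 1 / 2 else 0 := by
      intro w
      split_ifs <;> norm_num
    simp only [h, Finset.sum_sub_distrib, Finset.sum_ite_eq', Finset.mem_univ, if_true,
      Finset.sum_const, Finset.card_univ, Fintype.card_fin, nsmul_eq_mul]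
    field_simp
  have hterm : ∀ u : Fin n, greenExp n k t
      (fun q _ => 2 ^ s * ∏ a, if q a = u then (1 / 2 : ℝ) else 1) ≤
        2 ^ s * Real.exp (-(k / (2 * n))) := by
    intro u
    rw [greenExp_const_mul, greenExp_prod hn t fun w => if w = u then (1 / 2 : ℝ) else 1, hsum]
    refine mul_le_mul_of_nonneg_left ?_ (by positivity)
    have h1 : (0 : ℝ) ≤ 1 - 1 / (2 * n) := by
      rw [sub_nonneg, div_le_one (by linarith)]
      linarith
    refine (pow_le_pow_left₀ h1 (Real.one_sub_le_exp_neg _) k).trans (le_of_eq ?_)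
    rw [← Real.exp_nat_mul]
    congr 1
    ring
  refine (Finset.sum_le_card_nsmul _ _ _ fun u _ => hterm u).trans (le_of_eq ?_)
  rw [Finset.card_univ, Fintype.card_fin, nsmul_eq_mul, mul_assoc]

end GreenExp

section Captured

variable {n k : ℕ}

theorem mem_captured_spread {S : Finset (Fin k)} (r : Fin k → Fin n) {a : Fin k} (ha : a ∈ S) :
    r a ∈ captured r (spread r S) := by
  simp only [captured, spread, Finset.mem_filter, Finset.mem_univ, true_and, Finset.mem_union]
  exact fun b hb => Or.inr ⟨a, ha, hb⟩

theorem mul_le_card_filter_of_subset_captured {q : Fin k → Fin n} {S : Finset (Fin k)} {s : ℕ}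
    (hs : ∀ u, s ≤ (Finset.univ.filter fun a => q a = u).card) {C : Finset (Fin n)}
    (hC : C ⊆ captured q S) : C.card * s ≤ (S.filter fun a => q a ∈ C).card := by
  have hmaps : ∀ a ∈ S.filter (fun a => q a ∈ C), q a ∈ C := fun a ha => (Finset.mem_filter.1 ha).2
  rw [Finset.card_eq_sum_card_fiberwise hmaps, ← smul_eq_mul]
  refine Finset.card_nsmul_le_sum _ _ _ fun u hu => (hs u).trans (Finset.card_le_card ?_)
  intro a ha
  have hau : q a = u := (Finset.mem_filter.1 ha).2
  have haS := (Finset.mem_filter.1 (hC hu)).2 a hau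
  simp [hau, haS, hu]

theorem indepExp_captured_lt_le (hn : 2 ≤ n) (q : Fin k → Fin n) (S : Finset (Fin k)) {v : ℕ}
    (hv : v ≤ n) :
    indepExp (fun a => moveProb (q a))
      (fun r => if (captured r (spread r S)).card < v then 1 else 0) ≤
        (n : ℝ) ^ v * (v / ((n : ℝ) - 1)) ^ S.card := by
  have hn' : (2 : ℝ) ≤ n := by exact_mod_cast hn
  have hpt : ∀ r : Fin k → Fin n,
      (if (captured r (spread r S)).card < v then (1 : ℝ) else 0) ≤
        ∑ U ∈ Finset.powersetCard v Finset.univ, if ∀ a ∈ S, r a ∈ U then 1 else 0 := by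
    intro r
    split_ifs with h
    · obtain ⟨U, hU, hUv⟩ := Finset.exists_superset_card_eq (s := captured r (spread r S)) h.le
        (by simpa using hv)
      have hmem : U ∈ Finset.powersetCard v Finset.univ :=
        Finset.mem_powersetCard.2 ⟨Finset.subset_univ _, hUv⟩
      refine le_trans ?_ (Finset.single_le_sum (fun _ _ => by positivity) hmem)
      rw [if_pos fun a ha => hU (mem_captured_spread r ha)]
    · positivity
  refine (indepExp_mono (μ := fun a => moveProb (q a))
    (fun a w => moveProb_nonneg (by omega) (q a) w) hpt).trans ?_
  rw [indepExp_sum]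
  refine (Finset.sum_le_card_nsmul _ _ ((v / ((n : ℝ) - 1)) ^ S.card) fun U hU => ?_).trans ?_
  · refine indepExp_forall_mem_le (μ := fun a => moveProb (q a))
      (fun a w => moveProb_nonneg (by omega) (q a) w) (fun a => sum_moveProb hn (q a))
      (subset_refl S) U fun a _ => ?_
    rw [← (Finset.mem_powersetCard.1 hU).2]
    exact sum_moveProb_le (by omega) _ _
  · rw [nsmul_eq_mul, Finset.card_powersetCard, Finset.card_univ, Fintype.card_fin]
    refine mul_le_mul_of_nonneg_right ?_
      (pow_nonneg (div_nonneg (Nat.cast_nonneg _) (by linarith)) _)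
    exact_mod_cast Nat.choose_le_pow n v

theorem indepExp_captured_lt_univ_le (hn : 2 ≤ n) (q : Fin k → Fin n) (S : Finset (Fin k))
    {m : ℕ} (hm : ∀ u, m ≤ (S.filter fun a => u ≠ q a).card) :
    indepExp (fun a => moveProb (q a))
      (fun r => if (captured r (spread r S)).card < n then 1 else 0) ≤
        n * (1 - ((n : ℝ) - 1)⁻¹) ^ m := by
  have hn' : (2 : ℝ) ≤ n := by exact_mod_cast hn
  have hc0 : (0 : ℝ) ≤ 1 - ((n : ℝ) - 1)⁻¹ := sub_nonneg.2 (inv_le_one_of_one_le₀ (by linarith))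
  have hc1 : 1 - ((n : ℝ) - 1)⁻¹ ≤ 1 := sub_le_self _ (inv_nonneg.2 (by linarith))
  have hpt : ∀ r : Fin k → Fin n,
      (if (captured r (spread r S)).card < n then (1 : ℝ) else 0) ≤
        ∑ u, if ∀ a ∈ S, r a ∈ Finset.univ.erase u then 1 else 0 := by
    intro r
    split_ifs with h
    · obtain ⟨u, hu⟩ : ∃ u, u ∉ captured r (spread r S) := by
        by_contra! hall
        rw [Finset.eq_univ_iff_forall.2 hall, Finset.card_univ, Fintype.card_fin] at h
        exact h.false
      refine le_trans ?_ (Finset.single_le_sum (fun _ _ => by positivity) (Finset.mem_univ u))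
      rw [if_pos fun a ha => Finset.mem_erase.2
        ⟨fun hau => hu (by rw [← hau]; exact mem_captured_spread r ha), Finset.mem_univ _⟩]
    · positivity
  refine (indepExp_mono (μ := fun a => moveProb (q a))
    (fun a w => moveProb_nonneg (by omega) (q a) w) hpt).trans ?_
  rw [indepExp_sum]
  refine (Finset.sum_le_card_nsmul _ _ ((1 - ((n : ℝ) - 1)⁻¹) ^ m) fun u _ => ?_).trans ?_
  · refine (indepExp_forall_mem_le (μ := fun a => moveProb (q a))
      (c := 1 - ((n : ℝ) - 1)⁻¹) (fun a w => moveProb_nonneg (by omega) (q a) w)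
      (fun a => sum_moveProb hn (q a)) (Finset.filter_subset (fun a => u ≠ q a) S) _
      fun a ha => (sum_erase_moveProb hn (Finset.mem_filter.1 ha).2).le).trans ?_
    exact pow_le_pow_of_le_one hc0 hc1 (hm u)
  · rw [nsmul_eq_mul, Finset.card_univ, Fintype.card_fin]

theorem greenExp_captured_lt_one (hk : 1 ≤ k) :
    greenExp n k 0 (fun q S => if (captured q S).card < 1 then 1 else 0) = 0 := by
  refine Finset.sum_eq_zero fun r _ => mul_eq_zero_of_right _ (if_neg ?_)
  rw [not_lt, Finset.one_le_card]
  exact ⟨_, mem_captured_spread r (a := ⟨0, hk⟩) (by simp)⟩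

theorem greenExp_captured_lt_succ_le (hn : 2 ≤ n) (t : ℕ) {s v v' : ℕ} {ε : ℝ} (hε : 0 ≤ ε)
    (h : ∀ (q : Fin k → Fin n) (S : Finset (Fin k)), v ≤ (captured q S).card →
      (∀ u, s ≤ (Finset.univ.filter fun a => q a = u).card) →
      indepExp (fun a => moveProb (q a))
        (fun r => if (captured r (spread r S)).card < v' then 1 else 0) ≤ ε) :
    greenExp n k (t + 1) (fun q S => if (captured q S).card < v' then 1 else 0) ≤
      greenExp n k t (fun q S => if (captured q S).card < v then 1 else 0) +
        (n * 2 ^ s * Real.exp (-(k / (2 * n))) + ε) := by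
  have hpt : ∀ (q : Fin k → Fin n) (S : Finset (Fin k)), indepExp (fun a => moveProb (q a))
        (fun r => if (captured r (spread r S)).card < v' then 1 else 0) ≤
      (if (captured q S).card < v then 1 else 0) +
        ((if ∃ u, (Finset.univ.filter fun a => q a = u).card < s then 1 else 0) + ε) := by
    intro q S
    have h1 : indepExp (fun a => moveProb (q a))
        (fun r => if (captured r (spread r S)).card < v' then 1 else 0) ≤ 1 := by
      refine (indepExp_mono (μ := fun a => moveProb (q a)) (g := fun _ => 1)
        (fun a w => moveProb_nonneg (by omega) (q a) w) fun r => ?_).trans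
        (indepExp_const (μ := fun a => moveProb (q a)) (fun a => sum_moveProb hn (q a)) 1).le
      split_ifs <;> norm_num
    split_ifs with h2 h3 h3
    · linarith
    · linarith
    · linarith
    · push Not at h2 h3
      linarith [h q S h2 h3]
  refine (greenExp_mono (by omega) t hpt).trans ?_
  rw [greenExp_add, greenExp_add, greenExp_const hn]
  linarith [greenExp_exists_card_lt_le (k := k) hn t s]

end Captured

section ProbXi

variable {n k : ℕ}

theorem greenSet_congr {p p' : ℕ → Fin k → Fin n} (t : ℕ) (h : ∀ s ≤ t, p s = p' s) :
    greenSet n k p t = greenSet n k p' t := by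
  induction t with
  | zero => simp only [greenSet, h 0 le_rfl]
  | succ t ih => simp only [greenSet, ih fun s hs => h s (by omega), h (t + 1) le_rfl]

theorem sum_prefixProb_mul (T : ℕ) (F : (Fin k → Fin n) → Finset (Fin k) → ℝ) :
    ∑ p : Fin (T + 1) → Fin k → Fin n, prefixProb n k T p * F (p (Fin.last T))
      (greenSet n k (fun t a => p ⟨min t T, Nat.lt_succ_of_le (min_le_right t T)⟩ a) T) =
      greenExp n k T F := by
  induction T generalizing F with
  | zero =>
    rw [greenExp, indepExp, ← Equiv.sum_comp (Equiv.funUnique (Fin 1) (Fin k → Fin n)).symm]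
    refine Finset.sum_congr rfl fun r _ => ?_
    congr 1
    · simp [prefixProb]
    · congr 1
      ext a
      simp only [greenSet, spread, Finset.mem_filter, Finset.mem_univ, true_and, Finset.mem_union]
      constructor
      · rintro ⟨b, hb, hab⟩
        exact Or.inr ⟨b, hb, hab⟩
      · rintro (ha | ⟨b, hb, hab⟩)
        · exact ⟨a, ha, rfl⟩
        · exact ⟨b, hb, hab⟩
  | succ T ih =>
    rw [greenExp, ← ih, ← Equiv.sum_comp (Fin.snocEquiv fun _ => Fin k → Fin n),
      Fintype.sum_prod_type_right]
    refine Finset.sum_congr rfl fun p _ => ?_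
    rw [indepExp, Finset.mul_sum]
    refine Finset.sum_congr rfl fun r _ => ?_
    have hprob : prefixProb n k (T + 1) (Fin.snocEquiv (fun _ => Fin k → Fin n) (r, p)) =
        prefixProb n k T p * ∏ a, moveProb (p (Fin.last T) a) (r a) := by
      simp only [prefixProb, ← Finset.prod_mul_distrib]
      refine Finset.prod_congr rfl fun a _ => ?_
      rw [Fin.prod_univ_castSucc, mul_assoc]
      simp [Fin.snocEquiv, moveProb, ← Fin.castSucc_succ]
    have hgreen : greenSet n k (fun t a => Fin.snocEquiv (fun _ => Fin k → Fin n) (r, p)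
          ⟨min t (T + 1), Nat.lt_succ_of_le (min_le_right t (T + 1))⟩ a) (T + 1) =
        spread r (greenSet n k
          (fun t a => p ⟨min t T, Nat.lt_succ_of_le (min_le_right t T)⟩ a) T) := by
      rw [greenSet, greenSet_congr (p' := fun t a =>
        p ⟨min t T, Nat.lt_succ_of_le (min_le_right t T)⟩ a) T]
      · simp [spread, Fin.snocEquiv, Fin.snoc]
      · intro s hs
        have h1 : min s (T + 1) = s := by omega
        have h2 : min s T = s := by omega
        funext a
        simp [Fin.snocEquiv, Fin.snoc, h1, h2]
        rw [dif_pos hs]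
    rw [hprob, hgreen, mul_assoc]
    simp [Fin.snocEquiv]

theorem probXiLe_eq_greenExp (T : ℕ) :
    probXiLe n k T = greenExp n k T fun _ S => if S = Finset.univ then 1 else 0 := by
  rw [← sum_prefixProb_mul]
  simp [probXiLe]

theorem probXiLe_nonneg (hn : 2 ≤ n) (T : ℕ) : 0 ≤ probXiLe n k T := by
  rw [probXiLe_eq_greenExp]
  refine (greenExp_const (n := n) (k := k) hn T 0).symm.le.trans
    (greenExp_mono (by omega) T fun _ S => ?_)
  split_ifs <;> norm_num

theorem probXiLe_le_one (hn : 2 ≤ n) (T : ℕ) : probXiLe n k T ≤ 1 := by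
  rw [probXiLe_eq_greenExp]
  refine (greenExp_mono (by omega) T fun _ S => ?_).trans
    (greenExp_const (n := n) (k := k) hn T 1).le
  split_ifs <;> norm_num

theorem probXiLe_mul_le (hn : 2 ≤ n) (T : ℕ) :
    k * probXiLe n k T ≤ (1 + k * ((n : ℝ) - 1)⁻¹) ^ (T + 1) := by
  rw [probXiLe_eq_greenExp, ← greenExp_const_mul]
  refine (greenExp_mono (by omega) T fun _ S => ?_).trans (greenExp_card_le hn T)
  split_ifs with h
  · simp [h]
  · simp

theorem one_sub_probXiLe_le (hn : 2 ≤ n) (T : ℕ) :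
    1 - probXiLe n k T ≤
      greenExp n k T fun q S => if (captured q S).card < n then 1 else 0 := by
  rw [probXiLe_eq_greenExp, sub_le_iff_le_add', ← greenExp_add]
  refine (greenExp_const (n := n) (k := k) hn T 1).symm.le.trans
    (greenExp_mono (by omega) T fun q S => ?_)
  split_ifs with h1 h2 h2
  · norm_num
  · norm_num
  · norm_num
  · refine absurd (Finset.eq_univ_iff_forall.2 fun a => ?_) h1
    have h3 : captured q S = Finset.univ := by
      rw [← Finset.card_eq_iff_eq_univ, Fintype.card_fin]
      exact le_antisymm (card_finset_fin_le _) (not_lt.1 h2)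
    have h4 : q a ∈ captured q S := by rw [h3]; exact Finset.mem_univ _
    exact (Finset.mem_filter.1 h4).2 a rfl

theorem greenExp_captured_lt_pow_le (hn : 2 ≤ n) (hk : 1 ≤ k) {b c N : ℕ} (hb : 1 ≤ b)
    (hbN : b ^ N ≤ n) (hc : ((b : ℝ) ^ N / ((n : ℝ) - 1)) ^ c ≤ ((n : ℝ) ^ 2)⁻¹) (t : ℕ)
    (ht : t ≤ N) :
    greenExp n k t (fun q S => if (captured q S).card < b ^ t then 1 else 0) ≤
      t * (n * 2 ^ (c * b) * Real.exp (-(k / (2 * n))) + (n : ℝ)⁻¹) := by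
  have hn' : (2 : ℝ) ≤ n := by exact_mod_cast hn
  have hb' : (1 : ℝ) ≤ b := by exact_mod_cast hb
  have hinv : (n : ℝ)⁻¹ ≤ 1 := inv_le_one_of_one_le₀ (by linarith)
  induction t with
  | zero => rw [pow_zero, greenExp_captured_lt_one hk, Nat.cast_zero, zero_mul]
  | succ t ih =>
    refine (greenExp_captured_lt_succ_le hn t (s := c * b) (v := b ^ t) (ε := (n : ℝ)⁻¹)
      (by positivity) ?_).trans ?_
    · intro q S hv hs
      have hle : b ^ (t + 1) ≤ b ^ N := Nat.pow_le_pow_right hb ht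
      have hle' : (b : ℝ) ^ (t + 1) ≤ b ^ N := by exact_mod_cast hle
      refine (indepExp_captured_lt_le hn q S (hle.trans hbN)).trans ?_
      have hS : b ^ (t + 1) * c ≤ S.card := by
        have h1 := (mul_le_card_filter_of_subset_captured hs (subset_refl (captured q S))).trans
          (Finset.card_filter_le _ _)
        calc b ^ (t + 1) * c = b ^ t * (c * b) := by ring
          _ ≤ _ := (Nat.mul_le_mul_right _ hv).trans h1
      set ρ : ℝ := (b : ℝ) ^ (t + 1) / ((n : ℝ) - 1) with hρ
      have hρ0 : 0 ≤ ρ := div_nonneg (by positivity) (by linarith)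
      have hρN : ρ ^ c ≤ ((n : ℝ) ^ 2)⁻¹ := by
        refine (pow_le_pow_left₀ hρ0 ?_ c).trans hc
        exact div_le_div_of_nonneg_right hle' (by linarith)
      have hρ1 : ρ ^ c < 1 := hρN.trans_lt (inv_lt_one_of_one_lt₀ (by nlinarith))
      have hρ1' : ρ ≤ 1 := by
        by_contra! hcon
        exact hρ1.not_ge (one_le_pow₀ hcon.le)
      rw [Nat.cast_pow, ← hρ]
      calc (n : ℝ) ^ b ^ (t + 1) * ρ ^ S.card
          ≤ (n : ℝ) ^ b ^ (t + 1) * ρ ^ (b ^ (t + 1) * c) :=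
            mul_le_mul_of_nonneg_left (pow_le_pow_of_le_one hρ0 hρ1' hS) (by positivity)
        _ = (n * ρ ^ c) ^ b ^ (t + 1) := by
            rw [mul_pow, ← pow_mul, mul_comm c]
        _ ≤ ((n : ℝ)⁻¹) ^ b ^ (t + 1) := by
            refine pow_le_pow_left₀ (by positivity) ?_ _
            calc (n : ℝ) * ρ ^ c ≤ n * ((n : ℝ) ^ 2)⁻¹ :=
                  mul_le_mul_of_nonneg_left hρN (by positivity)
              _ = (n : ℝ)⁻¹ := by field_simp
        _ ≤ (n : ℝ)⁻¹ := pow_le_of_le_one (by positivity) hinv (pow_pos hb _).ne'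
    · push_cast
      linarith [ih (by omega)]

theorem one_sub_probXiLe_succ_le (hn : 2 ≤ n) (hk : 1 ≤ k) {b c N : ℕ} (hN : 1 ≤ N)
    (hb : 2 ≤ b) (hc2 : 2 ≤ c) (hbN : b ^ N ≤ n)
    (hc : ((b : ℝ) ^ N / ((n : ℝ) - 1)) ^ c ≤ ((n : ℝ) ^ 2)⁻¹) :
    1 - probXiLe n k (N + 1) ≤
      (N + 1) * (n * 2 ^ (c * b) * Real.exp (-(k / (2 * n))) + (n : ℝ)⁻¹) +
        n * Real.exp (-((b : ℝ) ^ (N + 1) / n)) := by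
  have hn' : (2 : ℝ) ≤ n := by exact_mod_cast hn
  refine (one_sub_probXiLe_le hn (N + 1)).trans ?_
  refine (greenExp_captured_lt_succ_le hn N (s := c * b) (v := b ^ N)
    (ε := n * Real.exp (-((b : ℝ) ^ (N + 1) / n))) (by positivity) ?_).trans ?_
  · intro q S hv hs
    have hm : ∀ u, b ^ (N + 1) ≤ (S.filter fun a => u ≠ q a).card := by
      intro u
      have h1 := mul_le_card_filter_of_subset_captured hs
        (Finset.erase_subset u (captured q S))
      have h2 : (S.filter fun a => q a ∈ (captured q S).erase u).card ≤
          (S.filter fun a => u ≠ q a).card :=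
        Finset.card_le_card (Finset.monotone_filter_right _ fun a _ ha =>
          (Finset.ne_of_mem_erase ha).symm)
      have h3 : b ^ N - 1 ≤ ((captured q S).erase u).card :=
        (Nat.sub_le_sub_right hv 1).trans Finset.pred_card_le_card_erase
      have h4 : 2 ≤ b ^ N := hb.trans (Nat.le_self_pow (by omega) b)
      calc b ^ (N + 1) = b ^ N * b := pow_succ b N
        _ ≤ ((b ^ N - 1) * 2) * b := Nat.mul_le_mul_right _ (by omega)
        _ ≤ ((b ^ N - 1) * c) * b := Nat.mul_le_mul_right _ (Nat.mul_le_mul_left _ hc2)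
        _ = (b ^ N - 1) * (c * b) := mul_assoc _ _ _
        _ ≤ _ := (Nat.mul_le_mul_right _ h3).trans (h1.trans h2)
    refine (indepExp_captured_lt_univ_le hn q S hm).trans ?_
    refine mul_le_mul_of_nonneg_left ?_ (by positivity)
    have hle : (n : ℝ)⁻¹ ≤ ((n : ℝ) - 1)⁻¹ := inv_anti₀ (by linarith) (by linarith)
    have hc0 : (0 : ℝ) ≤ 1 - ((n : ℝ) - 1)⁻¹ :=
      sub_nonneg.2 (inv_le_one_of_one_le₀ (by linarith))
    have h5 : 1 - ((n : ℝ) - 1)⁻¹ ≤ Real.exp (-(n : ℝ)⁻¹) :=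
      (sub_le_sub_left hle 1).trans (Real.one_sub_le_exp_neg _)
    refine (pow_le_pow_left₀ hc0 h5 _).trans (le_of_eq ?_)
    rw [← Real.exp_nat_mul]
    congr 1
    push_cast
    ring
  · have h1 := greenExp_captured_lt_pow_le (k := k) hn hk (by omega) hbN hc N le_rfl
    have h2 : (0 : ℝ) ≤ (n : ℝ)⁻¹ := by positivity
    linarith

end ProbXi

section Asymptotics

theorem eventually_rpow_le_of_tendsto_log {k : ℕ → ℕ} {l z : ℝ}
    (hk : Tendsto (fun n => Real.log (k n) / Real.log n) atTop (nhds l)) (hz0 : 0 < z)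
    (hz : z < l) : ∀ᶠ n : ℕ in atTop, 1 ≤ k n ∧ (n : ℝ) ^ z ≤ k n := by
  filter_upwards [hk.eventually (eventually_gt_nhds hz), eventually_ge_atTop 2] with n h hn
  have hn' : (2 : ℝ) ≤ n := by exact_mod_cast hn
  have hlog : 0 < Real.log n := Real.log_pos (by linarith)
  rw [lt_div_iff₀ hlog] at h
  have hk1 : 1 ≤ k n := by
    rw [Nat.one_le_iff_ne_zero]
    intro h0
    rw [h0, Nat.cast_zero, Real.log_zero] at h
    exact (mul_pos hz0 hlog).not_gt h
  have hk1' : (1 : ℝ) ≤ k n := by exact_mod_cast hk1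
  refine ⟨hk1, ?_⟩
  rw [Real.rpow_def_of_pos (by linarith), ← Real.le_log_iff_exp_le (by linarith), mul_comm]
  exact h.le

theorem eventually_le_rpow_of_tendsto_log {k : ℕ → ℕ} {l z : ℝ}
    (hk : Tendsto (fun n => Real.log (k n) / Real.log n) atTop (nhds l))
    (hz : l < z) : ∀ᶠ n : ℕ in atTop, (k n : ℝ) ≤ (n : ℝ) ^ z := by
  filter_upwards [hk.eventually (eventually_lt_nhds hz), eventually_ge_atTop 2] with n h hn
  have hn' : (2 : ℝ) ≤ n := by exact_mod_cast hn
  have hlog : 0 < Real.log n := Real.log_pos (by linarith)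
  rw [div_lt_iff₀ hlog] at h
  rcases (Nat.cast_nonneg (α := ℝ) (k n)).eq_or_lt with h0 | h0
  · rw [← h0]
    positivity
  · rw [Real.rpow_def_of_pos (by linarith), ← Real.log_le_iff_le_exp h0, mul_comm]
    exact h.le

theorem tendsto_natCast_rpow_atTop {δ : ℝ} (hδ : 0 < δ) :
    Tendsto (fun n : ℕ => (n : ℝ) ^ δ) atTop atTop :=
  (tendsto_rpow_atTop hδ).comp tendsto_natCast_atTop_atTop

theorem tendsto_natCast_mul_exp_neg_rpow {C δ : ℝ} (hC : 0 < C) (hδ : 0 < δ) :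
    Tendsto (fun n : ℕ => (n : ℝ) * Real.exp (-(C * (n : ℝ) ^ δ))) atTop (nhds 0) := by
  refine ((tendsto_rpow_mul_exp_neg_mul_atTop_nhds_zero (1 / δ) C hC).comp
    (tendsto_natCast_rpow_atTop hδ)).congr fun n => ?_
  simp only [Function.comp]
  rw [← Real.rpow_mul (Nat.cast_nonneg n), mul_one_div_cancel hδ.ne', Real.rpow_one, neg_mul]

theorem tendsto_probXiLe_zero {k : ℕ → ℕ} {N : ℕ} {x : ℝ} (hx0 : 0 < x) (hx : x * N < 1)
    (hk : Tendsto (fun n => Real.log (k n) / Real.log n) atTop (nhds (1 + x))) :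
    Tendsto (fun n => probXiLe n (k n) N) atTop (nhds 0) := by
  obtain ⟨z, hxz, hz⟩ : ∃ z, x < z ∧ z * N < 1 := by
    have hcont : Tendsto (fun z : ℝ => z * N) (nhdsWithin x (Set.Ioi x)) (nhds (x * N)) :=
      ((continuous_id.mul continuous_const).tendsto x).mono_left nhdsWithin_le_nhds
    exact ((eventually_mem_nhdsWithin).and (hcont.eventually (eventually_lt_nhds hx))).exists
  have hlim : Tendsto (fun n : ℕ => (3 : ℝ) ^ (N + 1) * (n : ℝ) ^ (-(1 - z * N)))
      atTop (nhds 0) := by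
    have h := ((tendsto_rpow_neg_atTop (sub_pos.2 hz)).comp
      tendsto_natCast_atTop_atTop).const_mul ((3 : ℝ) ^ (N + 1))
    rwa [mul_zero] at h
  refine tendsto_of_tendsto_of_tendsto_of_le_of_le' tendsto_const_nhds hlim ?_ ?_
  · filter_upwards [eventually_ge_atTop 2] with n hn using probXiLe_nonneg hn N
  · filter_upwards [eventually_ge_atTop 2, eventually_le_rpow_of_tendsto_log hk
      (add_lt_add_right hxz 1), eventually_rpow_le_of_tendsto_log hk one_pos (by linarith)]
      with n hn hkz hkn
    obtain ⟨hk1, hkn⟩ := hkn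
    rw [Real.rpow_one] at hkn
    have hn' : (2 : ℝ) ≤ n := by exact_mod_cast hn
    have hn0 : (0 : ℝ) < n := by linarith
    have hk0 : (0 : ℝ) < k n := by exact_mod_cast hk1
    have hbase : 1 + k n * ((n : ℝ) - 1)⁻¹ ≤ 3 * (k n / n) := by
      have h1 : 1 ≤ (k n : ℝ) / n := (one_le_div hn0).2 hkn
      have h2 : ((n : ℝ) - 1)⁻¹ ≤ 2 / n := by
        rw [inv_eq_one_div, div_le_div_iff₀ (by linarith) hn0]
        linarith
      have h3 := mul_le_mul_of_nonneg_left h2 hk0.le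
      have h4 : (k n : ℝ) * (2 / n) = 2 * (k n / n) := by ring
      linarith
    have hbase0 : 0 ≤ 1 + k n * ((n : ℝ) - 1)⁻¹ :=
      add_nonneg zero_le_one (mul_nonneg hk0.le (inv_nonneg.2 (by linarith)))
    have hmain := (probXiLe_mul_le (k := k n) hn N).trans (pow_le_pow_left₀ hbase0 hbase _)
    have hle : probXiLe n (k n) N ≤ 3 ^ (N + 1) * ((k n : ℝ) ^ N / n ^ (N + 1)) := by
      refine le_of_mul_le_mul_left (hmain.trans (le_of_eq ?_)) hk0
      rw [mul_pow, div_pow]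
      ring
    refine hle.trans (mul_le_mul_of_nonneg_left ?_ (by positivity))
    rw [div_le_iff₀ (by positivity), ← Real.rpow_natCast (n : ℝ), ← Real.rpow_add hn0]
    refine (pow_le_pow_left₀ hk0.le hkz N).trans (le_of_eq ?_)
    rw [← Real.rpow_natCast, ← Real.rpow_mul hn0.le]
    congr 1
    push_cast
    ring

theorem tendsto_probXiLe_one {k : ℕ → ℕ} {N : ℕ} (hN : 1 ≤ N) {x : ℝ} (hx : x * N < 1)
    (hx' : 1 < x * (N + 1))
    (hk : Tendsto (fun n => Real.log (k n) / Real.log n) atTop (nhds (1 + x))) :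
    Tendsto (fun n => probXiLe n (k n) (N + 1)) atTop (nhds 1) := by
  have hN0 : (0 : ℝ) < N := by exact_mod_cast hN
  obtain ⟨y, hy, hyx⟩ : ∃ y, 1 / ((N : ℝ) + 1) < y ∧ y < x :=
    exists_between ((div_lt_iff₀ (by positivity)).2 hx')
  obtain ⟨z, hyz, hzx⟩ := exists_between hyx
  have hy0 : 0 < y := lt_trans (by positivity) hy
  have hy1 : 0 < y * (N + 1) - 1 := sub_pos.2 ((div_lt_iff₀ (by positivity)).1 hy)
  have hyN : 0 < 1 - y * N :=
    sub_pos.2 ((mul_lt_mul_of_pos_right hyx hN0).trans hx)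
  obtain ⟨c, hc⟩ := exists_nat_ge (max 2 (3 / (1 - y * N)))
  have hc2 : 2 ≤ c := by exact_mod_cast (le_max_left _ _).trans hc
  have hc3 : 3 ≤ c * (1 - y * N) := (div_le_iff₀ hyN).1 ((le_max_right _ _).trans hc)
  have hlim : Tendsto (fun n : ℕ =>
      (N + 1) * ((n : ℝ) * Real.exp (-(1 / 4 * (n : ℝ) ^ z)) + (n : ℝ)⁻¹) +
        n * Real.exp (-((1 / 2) ^ (N + 1) * (n : ℝ) ^ (y * (N + 1) - 1)))) atTop (nhds 0) := by
    have h := (((tendsto_natCast_mul_exp_neg_rpow (C := 1 / 4) (by norm_num)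
      (hy0.trans hyz)).add (tendsto_inv_atTop_zero.comp
        (tendsto_natCast_atTop_atTop (R := ℝ)))).const_mul ((N : ℝ) + 1)).add
      (tendsto_natCast_mul_exp_neg_rpow (C := (1 / 2) ^ (N + 1)) (by positivity) hy1)
    simpa using h
  suffices hsub : Tendsto (fun n => 1 - probXiLe n (k n) (N + 1)) atTop (nhds 0) by
    simpa using hsub.const_sub 1
  refine tendsto_of_tendsto_of_tendsto_of_le_of_le' tendsto_const_nhds hlim ?_ ?_
  · filter_upwards [eventually_ge_atTop 2] with n hn using
      sub_nonneg.2 (probXiLe_le_one hn (N + 1))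
  · filter_upwards [eventually_ge_atTop 2, eventually_ge_atTop (2 ^ c),
      eventually_rpow_le_of_tendsto_log hk (by linarith) (add_lt_add_right hzx 1),
      (tendsto_natCast_rpow_atTop hy0).eventually_ge_atTop 2,
      (tendsto_natCast_rpow_atTop (sub_pos.2 hyz)).eventually_ge_atTop (4 * (c : ℝ))]
      with n hn hnc hkn hny hnz
    obtain ⟨hk1, hkz⟩ := hkn
    have hn' : (2 : ℝ) ≤ n := by exact_mod_cast hn
    have hn0 : (0 : ℝ) < n := by linarith
    have hnc' : (2 : ℝ) ^ c ≤ n := by exact_mod_cast hnc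
    obtain ⟨b, hbdef⟩ : ∃ b, b = ⌊(n : ℝ) ^ y⌋₊ := ⟨_, rfl⟩
    have hb2 : 2 ≤ b := hbdef ▸ Nat.le_floor (by exact_mod_cast hny)
    have hble : (b : ℝ) ≤ (n : ℝ) ^ y := hbdef ▸ Nat.floor_le (by positivity)
    have hbge : 1 / 2 * (n : ℝ) ^ y ≤ b := by
      have h := Nat.lt_floor_add_one ((n : ℝ) ^ y)
      rw [← hbdef] at h
      linarith
    have hbpow : (b : ℝ) ^ N ≤ (n : ℝ) ^ (y * N) := by
      rw [Real.rpow_mul hn0.le, Real.rpow_natCast]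
      exact pow_le_pow_left₀ (by positivity) hble N
    have hbN : b ^ N ≤ n := by
      have h : (n : ℝ) ^ (y * N) ≤ (n : ℝ) ^ (1 : ℝ) :=
        Real.rpow_le_rpow_of_exponent_le (by linarith) (by linarith)
      rw [Real.rpow_one] at h
      exact_mod_cast hbpow.trans h
    have hcb : ((b : ℝ) ^ N / ((n : ℝ) - 1)) ^ c ≤ ((n : ℝ) ^ 2)⁻¹ := by
      have h1 : (b : ℝ) ^ N / ((n : ℝ) - 1) ≤ 2 * (n : ℝ) ^ (-(1 - y * N)) := by
        rw [div_le_iff₀ (by linarith)]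
        have h2 : (n : ℝ) ^ (y * N) = (n : ℝ) ^ (-(1 - y * N)) * n := by
          rw [← Real.rpow_add_one hn0.ne']
          congr 1
          ring
        have h3 : 0 < (n : ℝ) ^ (-(1 - y * N)) := by positivity
        nlinarith
      have h4 : ((n : ℝ) ^ (-(1 - y * N))) ^ c ≤ (n : ℝ) ^ (-(3 : ℝ)) := by
        rw [← Real.rpow_natCast, ← Real.rpow_mul hn0.le]
        exact Real.rpow_le_rpow_of_exponent_le (by linarith) (by linarith)
      calc ((b : ℝ) ^ N / ((n : ℝ) - 1)) ^ c ≤ (2 * (n : ℝ) ^ (-(1 - y * N))) ^ c :=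
            pow_le_pow_left₀ (div_nonneg (by positivity) (by linarith)) h1 c
        _ = 2 ^ c * ((n : ℝ) ^ (-(1 - y * N))) ^ c := mul_pow _ _ _
        _ ≤ n * (n : ℝ) ^ (-(3 : ℝ)) := mul_le_mul hnc' h4 (by positivity) hn0.le
        _ = ((n : ℝ) ^ 2)⁻¹ := by
            rw [Real.rpow_neg hn0.le, show (3 : ℝ) = ((3 : ℕ) : ℝ) by norm_num,
              Real.rpow_natCast]
            field_simp
    refine (one_sub_probXiLe_succ_le hn hk1 hN hb2 hc2 hbN hcb).trans ?_
    have hocc : (2 : ℝ) ^ (c * b) * Real.exp (-(k n / (2 * n))) ≤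
        Real.exp (-(1 / 4 * (n : ℝ) ^ z)) := by
      have h1 : (2 : ℝ) ^ (c * b) ≤ Real.exp (c * b) := by
        have h2 : (2 : ℝ) ≤ Real.exp 1 := by linarith [Real.add_one_le_exp (1 : ℝ)]
        have h3 := pow_le_pow_left₀ zero_le_two h2 (c * b)
        rwa [← Real.exp_nat_mul, mul_one, Nat.cast_mul] at h3
      have h4 : (c : ℝ) * b ≤ 1 / 4 * (n : ℝ) ^ z := by
        have h5 : (n : ℝ) ^ z = (n : ℝ) ^ (z - y) * (n : ℝ) ^ y := by
          rw [← Real.rpow_add hn0]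
          congr 1
          ring
        have h6 := mul_le_mul_of_nonneg_right hnz (Real.rpow_nonneg hn0.le y)
        have h7 := mul_le_mul_of_nonneg_left hble (Nat.cast_nonneg (α := ℝ) c)
        rw [h5]
        linarith
      have h8 : 1 / 2 * (n : ℝ) ^ z ≤ k n / (2 * n) := by
        rw [le_div_iff₀ (by positivity)]
        rw [Real.rpow_add hn0, Real.rpow_one] at hkz
        linarith
      refine (mul_le_mul_of_nonneg_right h1 (by positivity)).trans ?_
      rw [← Real.exp_add]
      exact Real.exp_le_exp.2 (by linarith)
    have hfin : (1 / 2) ^ (N + 1) * (n : ℝ) ^ (y * (N + 1) - 1) ≤ (b : ℝ) ^ (N + 1) / n := by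
      have h1 := pow_le_pow_left₀ (by positivity) hbge (N + 1)
      rw [mul_pow, ← Real.rpow_natCast ((n : ℝ) ^ y), ← Real.rpow_mul hn0.le] at h1
      rw [Real.rpow_sub hn0, Real.rpow_one, ← mul_div_assoc]
      refine div_le_div_of_nonneg_right ?_ hn0.le
      exact_mod_cast h1
    refine add_le_add (mul_le_mul_of_nonneg_left ?_ (by positivity))
      (mul_le_mul_of_nonneg_left (Real.exp_le_exp.2 (neg_le_neg hfin)) hn0.le)
    rw [mul_assoc]
    linarith [mul_le_mul_of_nonneg_left hocc hn0.le]

end Asymptotics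

theorem probXiMem_singleton (n k i : ℕ) : probXiMem n k {i} = probXiEq n k i := by
  have h : ∀ t ≠ i, ({i} : Set ℕ).indicator (probXiEq n k) t = 0 := fun t ht =>
    Set.indicator_of_notMem (s := {i}) ht _
  rw [probXiMem, tsum_eq_single i h]
  exact Set.indicator_of_mem (s := {i}) rfl _

/-- **Theorem 1.1(e).**  Fix an integer `i ≥ 3` and a real `x` with `1/i < x < 1/(i−1)`, and
suppose `k = k(n) = n^{1+x+o(1)}`, i.e. `ln k(n)/ln n → 1 + x`.  Then a.a.s.
`ξ(K_n, k) = i`. -/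
theorem broadcasting_time_polynomial_k
    (i : ℕ) (hi : 3 ≤ i) (x : ℝ)
    (hx1 : 1 / (i : ℝ) < x) (hx2 : x < 1 / ((i : ℝ) - 1))
    (k : ℕ → ℕ)
    (hk : Tendsto (fun n => Real.log (k n) / Real.log n) atTop (nhds (1 + x))) :
    Tendsto (fun n => probXiMem n (k n) {i}) atTop (nhds 1) := by
  obtain ⟨N, rfl⟩ : ∃ N, i = N + 1 := ⟨i - 1, by omega⟩
  have hN : 2 ≤ N := by omega
  have hN' : (2 : ℝ) ≤ N := by exact_mod_cast hN
  push_cast at hx1 hx2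
  rw [add_sub_cancel_right, lt_div_iff₀ (by linarith)] at hx2
  have hx0 : 0 < x := lt_trans (by positivity) hx1
  rw [div_lt_iff₀ (by linarith)] at hx1
  have h := (tendsto_probXiLe_one (by omega) hx2 hx1 hk).sub (tendsto_probXiLe_zero hx0 hx2 hk)
  rw [sub_zero] at h
  exact h.congr fun n => (probXiMem_singleton n (k n) (N + 1)).symm
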